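/- arXiv:2004.14926 — 3 statements merged into one kernel-verified Lean document; each statement's English description precedes it below -/
import Mathlib

section
/- Let M, M', N, N' be natural numbers with M − N ≠ M' − N'. Then the set of parameters α ∈ [0,1] such that T_α^M(α−1) = T_α^N(α) and T_α^{M'}(α−1) = T_α^{N'}(α) is at most countable. -/
open Set Filter MeasureTheory

/-- The Tanaka–Ito `α`-continued fraction map. -/
noncomputable def T (α x : ℝ) : ℝ := if x = 0 then 0 else 1 / x - (⌊1 / x + 1 - α⌋ : ℝ)

lemma T_mem_Icc {α x : ℝ} (hx : x ≠ 0) : T α x ∈ Icc (α - 1) α := by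
  have h₁ := Int.floor_le (1 / x + 1 - α)
  have h₂ := Int.lt_floor_add_one (1 / x + 1 - α)
  simp only [T, if_neg hx, mem_Icc]
  constructor <;> linarith

lemma Transcendental.T {α x : ℝ} (hx : Transcendental ℚ x) : Transcendental ℚ (T α x) := by
  have hx₀ : x ≠ 0 := fun h => hx (h ▸ isAlgebraic_zero)
  intro halg
  have h := (halg.add (isAlgebraic_intCast (R := ℚ) (A := ℝ) ⌊1 / x + 1 - α⌋)).inv
  simp only [_root_.T, if_neg hx₀, sub_add_cancel, one_div, inv_inv] at h
  exact hx h

lemma Transcendental.iterate_T {α x : ℝ} (hx : Transcendental ℚ x) (k : ℕ) :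
    Transcendental ℚ ((_root_.T α)^[k] x) := by
  induction k with
  | zero => exact hx
  | succ k ih => rw [Function.iterate_succ_apply']; exact ih.T

lemma iterate_T_mem_Icc {α x : ℝ} (ht : Transcendental ℚ x) (hx : x ∈ Icc (α - 1) α) (k : ℕ) :
    (T α)^[k] x ∈ Icc (α - 1) α := by
  cases k with
  | zero => exact hx
  | succ k =>
    rw [Function.iterate_succ_apply']
    exact T_mem_Icc fun h => ht.iterate_T k (h ▸ isAlgebraic_zero)

lemma Transcendental.abs_lt_one {α x : ℝ} (ht : Transcendental ℚ x) (hα : α ∈ Icc (0 : ℝ) 1)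
    (hx : x ∈ Icc (α - 1) α) : |x| < 1 := by
  refine lt_of_le_of_ne (abs_le.2 ⟨by linarith [hα.1, hx.1], by linarith [hα.2, hx.2]⟩) fun h => ?_
  rcases eq_or_eq_neg_of_abs_eq h with rfl | rfl
  · exact ht isAlgebraic_one
  · exact ht isAlgebraic_one.neg

/-- The iterates of `T α` are integral Möbius maps whose denominator is the product of the
preceding points of the orbit. -/
lemma exists_moebius_iterate_T {α x : ℝ} (ht : Transcendental ℚ x) (k : ℕ) :
    ∃ a b c d : ℤ, (T α)^[k] x * ∏ i ∈ Finset.range k, (T α)^[i] x = a * x + b ∧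
      ∏ i ∈ Finset.range k, (T α)^[i] x = c * x + d := by
  induction k with
  | zero => exact ⟨1, 0, 0, 1, by simp, by simp⟩
  | succ k ih =>
    obtain ⟨a, b, c, d, h₁, h₂⟩ := ih
    have h₀ : (T α)^[k] x ≠ 0 := fun h => ht.iterate_T k (h ▸ isAlgebraic_zero)
    refine ⟨c - ⌊1 / (T α)^[k] x + 1 - α⌋ * a, d - ⌊1 / (T α)^[k] x + 1 - α⌋ * b, a, b, ?_, ?_⟩
    · rw [Function.iterate_succ_apply', Finset.prod_range_succ, mul_comm (∏ i ∈ _, _)]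
      set y := (T α)^[k] x
      set p := ∏ i ∈ Finset.range k, (T α)^[i] x
      have : T α y * (y * p) = p - ⌊1 / y + 1 - α⌋ * (y * p) := by
        simp only [T, if_neg h₀]
        field_simp
      rw [this]
      push_cast
      linear_combination h₂ - ⌊1 / y + 1 - α⌋ * h₁
    · rw [Finset.prod_range_succ, mul_comm, h₁]

lemma Transcendental.quadratic_coeff_eq_zero {x : ℝ} (ht : Transcendental ℚ x) {a b c : ℤ}
    (h : a * x ^ 2 + b * x + c = 0) : a = 0 ∧ b = 0 ∧ c = 0 := by
  have hp : (Polynomial.C (a : ℚ) * Polynomial.X ^ 2 + Polynomial.C (b : ℚ) * Polynomial.X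
      + Polynomial.C (c : ℚ)) = 0 := by
    refine (transcendental_iff.1 ht) _ ?_
    simpa using h
  have h₀ := congrArg (Polynomial.coeff · 0) hp
  have h₁ := congrArg (Polynomial.coeff · 1) hp
  have h₂ := congrArg (Polynomial.coeff · 2) hp
  simp only [Polynomial.coeff_add, Polynomial.coeff_C_mul, Polynomial.coeff_X_pow,
    Polynomial.coeff_X, Polynomial.coeff_C, Polynomial.coeff_zero] at h₀ h₁ h₂
  norm_num at h₀ h₁ h₂
  exact ⟨h₂, h₁, h₀⟩

lemma iterate_T_ne_self {α x : ℝ} (hα : α ∈ Icc (0 : ℝ) 1) (ht : Transcendental ℚ x)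
    (hx : x ∈ Icc (α - 1) α) {k : ℕ} (hk : k ≠ 0) : (T α)^[k] x ≠ x := by
  intro hfix
  obtain ⟨a, b, c, d, h₁, h₂⟩ := exists_moebius_iterate_T (α := α) ht k
  have hne (i : ℕ) : (T α)^[i] x ≠ 0 := fun h => ht.iterate_T i (h ▸ isAlgebraic_zero)
  have hlt (i : ℕ) : |(T α)^[i] x| < 1 :=
    (ht.iterate_T i).abs_lt_one hα (iterate_T_mem_Icc ht hx i)
  have hprod : |∏ i ∈ Finset.range k, (T α)^[i] x| < 1 := by
    rw [Finset.abs_prod]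
    calc ∏ i ∈ Finset.range k, |(T α)^[i] x| < ∏ i ∈ Finset.range k, (1 : ℝ) :=
          Finset.prod_lt_prod_of_nonempty (fun i _ => abs_pos.2 (hne i)) (fun i _ => hlt i)
            (Finset.nonempty_range_iff.2 hk)
      _ = 1 := Finset.prod_const_one
  have hprod₀ : ∏ i ∈ Finset.range k, (T α)^[i] x ≠ 0 := Finset.prod_ne_zero_iff.2 fun i _ => hne i
  rw [hfix, h₂] at h₁
  rw [h₂] at hprod hprod₀
  obtain ⟨rfl, -, -⟩ := ht.quadratic_coeff_eq_zero (a := c) (b := d - a) (c := -b) (by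
    push_cast
    linear_combination h₁)
  simp only [Int.cast_zero, zero_mul, zero_add] at hprod hprod₀
  have hd : |d| < 1 := by exact_mod_cast hprod
  exact hprod₀ (by exact_mod_cast Int.abs_lt_one_iff.1 hd)

lemma injective_iterate_T {α x : ℝ} (hα : α ∈ Icc (0 : ℝ) 1) (ht : Transcendental ℚ x)
    (hx : x ∈ Icc (α - 1) α) : Function.Injective fun k => (T α)^[k] x := by
  intro m n h
  by_contra hne
  wlog hmn : m < n generalizing m n
  · exact this h.symm (Ne.symm hne) (by omega)
  refine iterate_T_ne_self hα (ht.iterate_T m) (iterate_T_mem_Icc ht hx m)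
    (Nat.sub_ne_zero_of_lt hmn) ?_
  rw [← Function.iterate_add_apply, Nat.sub_add_cancel hmn.le]
  exact h.symm

lemma sub_eq_sub_of_matching {α : ℝ} (hα : α ∈ Icc (0 : ℝ) 1) (ht : Transcendental ℚ α)
    {M M' N N' : ℕ} (hM : M ≤ M') (h : (T α)^[M] (α - 1) = (T α)^[N] α)
    (h' : (T α)^[M'] (α - 1) = (T α)^[N'] α) : (M : ℤ) - N = (M' : ℤ) - N' := by
  obtain ⟨k, rfl⟩ := Nat.exists_eq_add_of_le' hM
  rw [Function.iterate_add_apply, h, ← Function.iterate_add_apply] at h'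
  have := injective_iterate_T hα ht ⟨by linarith, le_rfl⟩ h'
  omega

theorem stmt0 (M M' N N' : ℕ) (h : (M : ℤ) - N ≠ (M' : ℤ) - N') :
    Set.Countable {α ∈ Set.Icc (0 : ℝ) 1 |
      (T α)^[M] (α - 1) = (T α)^[N] α ∧ (T α)^[M'] (α - 1) = (T α)^[N'] α} := by
  refine (Algebraic.countable ℚ ℝ).mono ?_
  rintro α ⟨hα, h₁, h₂⟩
  by_contra ht
  rcases le_total M M' with hM | hM
  · exact h (sub_eq_sub_of_matching hα ht hM h₁ h₂)
  · exact h (sub_eq_sub_of_matching hα ht hM h₂ h₁).symm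
end

section
/- Let g ≤ α ≤ β ≤ 1, x ∈ [α−1, α), y ∈ [β−1, β). Then: (i) if x = y, then T_β(y) − T_α(x) ∈ {0,1}; (ii) if y − x = 1, then (x+1)(T_β(y)+1) = 1; (iii) if (x+1)(y+1) = 1 or x + y = 0, then T_α(x) + T_β(y) ∈ {0,1}; (iv) if x + y = 1, then: T_β(y) − T_α^2(x) ∈ {0,1} if x > 1/(α+1); T_β^2(y) − T_α(x) ∈ {0,1} if y > 1/(β+1); and (T_α(x)+1)(T_β(y)+1) = 1 if x ≤ 1/(α+1) and y ≤ 1/(β+1). -/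
open Set Filter MeasureTheory

/-- The small golden mean `g = (√5 - 1)/2`. -/
noncomputable def g : ℝ := (Real.sqrt 5 - 1) / 2

theorem T_eq_one_div_sub_int {α x : ℝ} (hx : x ≠ 0) (n : ℤ) (h₁ : α - 1 ≤ 1 / x - n)
    (h₂ : 1 / x - n < α) : T α x = 1 / x - n := by
  have h : ⌊1 / x + 1 - α⌋ = n := Int.floor_eq_iff.mpr ⟨by linarith, by linarith⟩
  rw [T, if_neg hx, h]

theorem exists_T_eq {α x : ℝ} (hx : x ≠ 0) : ∃ n : ℤ, T α x = 1 / x - n :=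
  ⟨⌊1 / x + 1 - α⌋, by simp [T, hx]⟩

theorem T_mem_Ico {α : ℝ} (h₀ : 0 < α) (h₁ : α ≤ 1) (x : ℝ) : T α x ∈ Set.Ico (α - 1) α := by
  unfold T
  split_ifs with hx
  · exact ⟨by linarith, h₀⟩
  · have h := Int.floor_le (1 / x + 1 - α)
    have h' := Int.lt_floor_add_one (1 / x + 1 - α)
    exact ⟨by linarith, by linarith⟩

theorem eq_zero_or_one_of_eq_intCast {r : ℝ} (n : ℤ) (h : r = n) (h₁ : -1 < r) (h₂ : r < 2) :
    r = 0 ∨ r = 1 := by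
  subst h
  have h₁' : -1 < n := by exact_mod_cast h₁
  have h₂' : n < 2 := by exact_mod_cast h₂
  obtain rfl | rfl : n = 0 ∨ n = 1 := by omega
  · simp
  · simp

theorem g_mul_one_add_g : g * (1 + g) = 1 := by
  have h : Real.sqrt 5 ^ 2 = 5 := Real.sq_sqrt (by norm_num)
  unfold g
  nlinarith

theorem half_lt_g : 1 / 2 < g := by
  have h : (2 : ℝ) < Real.sqrt 5 := Real.lt_sqrt_of_sq_lt (by norm_num)
  unfold g
  linarith

/-- On `(1 / (α + 1), 1)` the first digit is `1`. -/
theorem T_eq_one_div_sub_one {α x : ℝ} (h₀ : 0 < α) (h₁ : α ≤ 1) (hx : 1 / (α + 1) < x)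
    (hx' : x ≤ 1) : T α x = 1 / x - 1 := by
  have hx₀ : 0 < x := lt_trans (by positivity) hx
  have hlow : 1 ≤ 1 / x := (one_le_div hx₀).mpr hx'
  have hup : 1 / x < α + 1 := (one_div_lt (by linarith) hx₀).mp hx
  simpa using T_eq_one_div_sub_int (α := α) hx₀.ne' 1 (by push_cast; linarith)
    (by push_cast; linarith)

/-- Just below `1 / (α + 1)` the first digit is `2`. -/
theorem T_eq_one_div_sub_two {α x : ℝ} (hx₀ : 0 < x) (h₀ : 0 < α) (hx : x ≤ 1 / (α + 1))
    (hx' : 1 < x * (2 + α)) : T α x = 1 / x - 2 := by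
  have hlow : α + 1 ≤ 1 / x := (le_one_div hx₀ (by linarith)).mp hx
  have hup : 1 / x < 2 + α := by
    rw [div_lt_iff₀ hx₀]
    linarith
  simpa using T_eq_one_div_sub_int (α := α) hx₀.ne' 2 (by push_cast; linarith)
    (by push_cast; linarith)

/-- If `x + y = 1` and `x` has first digit `1`, then `T α (T α x)` and `T β y` agree modulo `1`. -/
theorem exists_T_sub_T_T_eq {α β x y : ℝ} (h₀ : 0 < α) (h₁ : α ≤ 1) (hx : 1 / (α + 1) < x)
    (hy₀ : 0 < y) (h : x + y = 1) : ∃ n : ℤ, T β y - T α (T α x) = n := by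
  have hx₀ : 0 < x := lt_trans (by positivity) hx
  have hT : T α x = y / x := by
    rw [T_eq_one_div_sub_one h₀ h₁ hx (by linarith)]
    field_simp
    linarith
  obtain ⟨m, hm⟩ := exists_T_eq (α := α) (div_pos hy₀ hx₀).ne'
  obtain ⟨k, hk⟩ := exists_T_eq (α := β) hy₀.ne'
  refine ⟨m - k + 1, ?_⟩
  have hinv : 1 / (y / x) = 1 / y - 1 := by
    field_simp
    linarith
  rw [hT, hm, hk, hinv]
  push_cast
  ring

theorem stmt1 (α β x y : ℝ) (hg : g ≤ α) (hαβ : α ≤ β) (hβ : β ≤ 1)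
    (hx : x ∈ Set.Ico (α - 1) α) (hy : y ∈ Set.Ico (β - 1) β) :
    (x = y → T β y - T α x = 0 ∨ T β y - T α x = 1) ∧
    (y - x = 1 → (x + 1) * (T β y + 1) = 1) ∧
    ((x + 1) * (y + 1) = 1 ∨ x + y = 0 →
      T α x + T β y = 0 ∨ T α x + T β y = 1) ∧
    (x + y = 1 →
      (x > 1 / (α + 1) →
        T β y - (T α)^[2] x = 0 ∨ T β y - (T α)^[2] x = 1) ∧
      (y > 1 / (β + 1) →
        (T β)^[2] y - T α x = 0 ∨ (T β)^[2] y - T α x = 1) ∧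
      (x ≤ 1 / (α + 1) → y ≤ 1 / (β + 1) →
        (T α x + 1) * (T β y + 1) = 1)) := by
  have hgg := g_mul_one_add_g
  have hg₂ := half_lt_g
  have hα₀ : 0 < α := by linarith
  have hβ₀ : 0 < β := by linarith
  have hα₁ : α ≤ 1 := by linarith
  obtain ⟨hx₁, hx₂⟩ := hx
  obtain ⟨hy₁, hy₂⟩ := hy
  have hTα := T_mem_Ico hα₀ hα₁
  have hTβ := T_mem_Ico hβ₀ hβ
  refine ⟨?_, ?_, ?_, ?_⟩
  · rintro rfl
    have ⟨a₁, a₂⟩ := hTα x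
    have ⟨b₁, b₂⟩ := hTβ x
    rcases eq_or_ne x 0 with rfl | hx₀
    · simp [T]
    · obtain ⟨m, hm⟩ := exists_T_eq (α := α) hx₀
      obtain ⟨k, hk⟩ := exists_T_eq (α := β) hx₀
      refine eq_zero_or_one_of_eq_intCast (m - k) ?_ (by linarith) (by linarith)
      rw [hm, hk]
      push_cast
      ring
  · intro h
    have hy₀ : 0 < y := by linarith
    have hdigit : 1 / (β + 1) < y := by
      rw [div_lt_iff₀ (by linarith)]
      nlinarith
    rw [T_eq_one_div_sub_one hβ₀ hβ hdigit (by linarith), show x + 1 = y by linarith]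
    field_simp
    ring
  · intro h
    have ⟨a₁, a₂⟩ := hTα x
    have ⟨b₁, b₂⟩ := hTβ y
    rcases eq_or_ne x 0 with rfl | hx₀
    · have hy₀ : y = 0 := by rcases h with h | h <;> linarith
      simp [T, hy₀]
    · have hy₀ : y ≠ 0 := by
        rintro rfl
        rcases h with h | h <;> exact hx₀ (by linarith)
      obtain ⟨m, hm⟩ := exists_T_eq (α := α) hx₀
      obtain ⟨k, hk⟩ := exists_T_eq (α := β) hy₀
      obtain ⟨j, hj⟩ : ∃ j : ℤ, 1 / x + 1 / y = j := by
        rcases h with h | h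
        · refine ⟨-1, ?_⟩
          push_cast
          field_simp
          linarith
        · refine ⟨0, ?_⟩
          push_cast
          field_simp
          linarith
      refine eq_zero_or_one_of_eq_intCast (j - m - k) ?_ (by linarith) (by linarith)
      rw [hm, hk]
      push_cast
      linarith
  · intro h
    have hx₀ : 0 < x := by linarith
    have hy₀ : 0 < y := by linarith
    refine ⟨fun hx => ?_, fun hy => ?_, fun hx hy => ?_⟩
    · obtain ⟨n, hn⟩ := exists_T_sub_T_T_eq (β := β) hα₀ hα₁ hx hy₀ h
      have ⟨a₁, a₂⟩ := hTα (T α x)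
      have ⟨b₁, b₂⟩ := hTβ y
      change T β y - T α (T α x) = 0 ∨ T β y - T α (T α x) = 1
      exact eq_zero_or_one_of_eq_intCast n hn (by linarith) (by linarith)
    · obtain ⟨n, hn⟩ := exists_T_sub_T_T_eq (β := α) hβ₀ hβ hy hx₀ (by linarith)
      have ⟨a₁, a₂⟩ := hTα x
      have ⟨b₁, b₂⟩ := hTβ (T β y)
      change T β (T β y) - T α x = 0 ∨ T β (T β y) - T α x = 1
      refine eq_zero_or_one_of_eq_intCast (-n) ?_ (by linarith) (by linarith)
      push_cast
      linarith
    · have hx' := (le_div_iff₀ (by linarith)).mp hx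
      have hy' := (le_div_iff₀ (by linarith)).mp hy
      have hlow : 1 < x * (2 + α) ∧ 1 < y * (2 + β) := by
        rcases (hg.trans hαβ).eq_or_lt with hgβ | hgβ
        · obtain rfl : α = g := by linarith
          obtain rfl : β = g := hgβ.symm
          constructor <;> nlinarith
        · constructor
          · have : 1 < β * (1 + α) := by nlinarith
            nlinarith
          · have : 1 < α * (1 + β) := by nlinarith
            nlinarith
      rw [T_eq_one_div_sub_two hx₀ hα₀ hx hlow.1, T_eq_one_div_sub_two hy₀ hβ₀ hy hlow.2]
      field_simp
      nlinarith
end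

section
/- Let α ∈ [g,1] and set x_n = T_α^n(α−1), y_n = T_α^n(1/α − 1). Let m ∈ ℕ be such that x_n ≤ 1/(α+1) and y_n ≤ 1/(α+1) for all 0 ≤ n < m. Then for all 0 ≤ n ≤ m, the pair (x_n, y_n) satisfies at least one of the relations: (A) (x_n + 1)(y_n + 1) = 1, (B) x_n + y_n = 0, (C) x_n + y_n = 1. Moreover, if x_m > 1/(α+1) or y_m > 1/(α+1), then x_m + y_m = 1. -/
open Set Filter MeasureTheory

theorem g_sq : g ^ 2 + g = 1 := by
  have h : Real.sqrt 5 ^ 2 = 5 := Real.sq_sqrt (by norm_num)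
  unfold g
  nlinarith

theorem g_pos : 3 / 5 < g := by
  have h : (11 / 5 : ℝ) < Real.sqrt 5 := Real.lt_sqrt_of_sq_lt (by norm_num)
  unfold g
  linarith

theorem g_lt_one : g < 1 := by
  nlinarith [g_sq, g_pos]

theorem T_ne_zero (α : ℝ) {x : ℝ} (hx : x ≠ 0) : T α x = 1 / x - (⌊1 / x + 1 - α⌋ : ℝ) :=
  if_neg hx

theorem T_zero (α : ℝ) : T α 0 = 0 := if_pos rfl

/-- The value of `T α x` from the digit of `x`. -/
theorem T_eq_of_digit {α x : ℝ} (hx : x ≠ 0) (k : ℤ) (h₁ : α - 1 ≤ 1 / x - k)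
    (h₂ : 1 / x - k < α) : T α x = 1 / x - k := by
  have hk : ⌊1 / x + 1 - α⌋ = k := Int.floor_eq_iff.2 ⟨by linarith, by linarith⟩
  rw [T_ne_zero α hx, hk]

/-- If `1 / x + 1 / y` is an integer, then the images of `x` and `y` add up to `0` or `1`. -/
theorem T_add_T_of_inv_add_inv {α x y : ℝ} (h₀ : 1 / 2 < α) (h₁ : α ≤ 1) (hx : x ≠ 0)
    (hy : y ≠ 0) (k : ℤ) (h : 1 / x + 1 / y = k) : T α x + T α y = 0 ∨ T α x + T α y = 1 := by
  have bx := T_mem_Ico (by linarith) h₁ x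
  have bz := T_mem_Ico (by linarith) h₁ y
  obtain ⟨j, hj⟩ : ∃ j : ℤ, T α x + T α y = j := by
    refine ⟨k - ⌊1 / x + 1 - α⌋ - ⌊1 / y + 1 - α⌋, ?_⟩
    rw [T_ne_zero α hx, T_ne_zero α hy]
    push_cast
    linarith
  have hl : (-1 : ℝ) < j := by linarith [bx.1, bz.1]
  have hu : (j : ℝ) < 2 := by linarith [bx.2, bz.2]
  have hl' : -1 < j := by exact_mod_cast hl
  have hu' : j < 2 := by exact_mod_cast hu
  have : j = 0 ∨ j = 1 := by omega
  rw [hj]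
  exact_mod_cast this

theorem T_add_T_of_add_eq_zero {α x y : ℝ} (h₀ : 1 / 2 < α) (h₁ : α ≤ 1) (h : x + y = 0) :
    T α x + T α y = 0 ∨ T α x + T α y = 1 := by
  obtain rfl : y = -x := by linarith
  rcases eq_or_ne x 0 with rfl | hx
  · simp [T_zero]
  · exact T_add_T_of_inv_add_inv h₀ h₁ hx (neg_ne_zero.2 hx) 0 (by push_cast; field_simp; ring)

theorem T_add_T_of_mul_eq_one {α x y : ℝ} (h₀ : 1 / 2 < α) (h₁ : α ≤ 1)
    (h : (x + 1) * (y + 1) = 1) : T α x + T α y = 0 ∨ T α x + T α y = 1 := by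
  rcases eq_or_ne x 0 with rfl | hx
  · obtain rfl : y = 0 := by linarith
    simp [T_zero]
  · have hy : y ≠ 0 := by
      rintro rfl
      exact hx (by linarith)
    refine T_add_T_of_inv_add_inv h₀ h₁ hx hy (-1) ?_
    push_cast
    field_simp
    linarith

theorem T_of_add_eq_one {α x y : ℝ} (h₀ : g < α) (h : x + y = 1)
    (hx : x ≤ 1 / (α + 1)) (hy : y ≤ 1 / (α + 1)) : 0 < x ∧ T α x = 1 / x - 2 := by
  have hg := g_pos
  have hα : 1 < α ^ 2 + α := by nlinarith [g_sq]
  rw [le_div_iff₀ (by linarith)] at hx hy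
  have hx₀ : 0 < x := by nlinarith
  refine ⟨hx₀, ?_⟩
  have := T_eq_of_digit (α := α) hx₀.ne' 2 ?_ ?_
  · exact_mod_cast this
  · have : α + 1 ≤ 1 / x := by rw [le_div_iff₀ hx₀]; linarith
    push_cast
    linarith
  · have : 1 / x < α + 2 := by
      rw [div_lt_iff₀ hx₀]
      nlinarith
    push_cast
    linarith

theorem T_add_one_mul_T_add_one {α x y : ℝ} (h₀ : g < α) (h : x + y = 1)
    (hx : x ≤ 1 / (α + 1)) (hy : y ≤ 1 / (α + 1)) : (T α x + 1) * (T α y + 1) = 1 := by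
  obtain ⟨hx₀, ex⟩ := T_of_add_eq_one h₀ h hx hy
  obtain ⟨hy₀, ey⟩ := T_of_add_eq_one h₀ (by linarith) hy hx
  rw [ex, ey]
  obtain rfl : y = 1 - x := by linarith
  have := hy₀.ne'
  field_simp
  ring

theorem T_g_g : T g g = g - 1 := by
  have hp := g_pos
  have hs := g_sq
  have e : 1 / g = g + 1 := by
    rw [div_eq_iff (by linarith)]
    linarith
  rw [T_eq_of_digit (by linarith) 2 (by rw [e]; push_cast; linarith)
    (by rw [e]; push_cast; linarith), e]
  push_cast
  ring

theorem one_div_one_sub_g : 1 / (1 - g) = g + 2 := by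
  rw [div_eq_iff (by linarith [g_lt_one])]
  linarith [g_sq]

theorem T_g_one_sub_g : T g (1 - g) = g - 1 := by
  have hp := g_lt_one
  have e := one_div_one_sub_g
  rw [T_eq_of_digit (by linarith) 3 (by rw [e]; push_cast; linarith)
    (by rw [e]; push_cast; linarith), e]
  push_cast
  ring

theorem T_g_g_sub_one : T g (g - 1) = 1 - g := by
  have hp := g_lt_one
  have hp' := g_pos
  have e : 1 / (g - 1) = -(g + 2) := by
    rw [← one_div_one_sub_g, ← neg_sub 1 g, one_div_neg_eq_neg_one_div]
  rw [T_eq_of_digit (by linarith) (-3) (by rw [e]; push_cast; linarith)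
    (by rw [e]; push_cast; linarith), e]
  push_cast
  ring

theorem iterate_T_g_add_ne_one (n : ℕ) :
    (T g)^[n] (g - 1) + (T g)^[n] (1 / g - 1) ≠ 1 := by
  have hp := g_pos
  have hl := g_lt_one
  have e : 1 / g - 1 = g := by
    rw [sub_eq_iff_eq_add, div_eq_iff (by linarith)]
    linarith [g_sq]
  have key : ((T g)^[n] (g - 1) = g - 1 ∧ (T g)^[n] g = g) ∨
      ((T g)^[n] (g - 1) = 1 - g ∧ (T g)^[n] g = g - 1) ∨
      ((T g)^[n] (g - 1) = g - 1 ∧ (T g)^[n] g = 1 - g) := by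
    induction n with
    | zero => simp
    | succ n ih =>
      simp only [Function.iterate_succ_apply']
      rcases ih with ⟨a, b⟩ | ⟨a, b⟩ | ⟨a, b⟩ <;>
        simp [a, b, T_g_g, T_g_one_sub_g, T_g_g_sub_one]
  rw [e]
  rcases key with ⟨a, b⟩ | ⟨a, b⟩ | ⟨a, b⟩ <;> rw [a, b] <;> intro h <;> linarith

theorem sub_one_le_iterate_T {α x : ℝ} (h₀ : 0 < α) (h₁ : α ≤ 1) (hx : α - 1 ≤ x) (n : ℕ) :
    α - 1 ≤ (T α)^[n] x := by
  cases n with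
  | zero => exact hx
  | succ n =>
    rw [Function.iterate_succ_apply']
    exact (T_mem_Ico h₀ h₁ _).1

theorem add_eq_one_of_one_div_lt {α x y : ℝ} (h₀ : g ≤ α) (hx : α - 1 ≤ x) (hy : α - 1 ≤ y)
    (h : (x + 1) * (y + 1) = 1 ∨ x + y = 0 ∨ x + y = 1) (hlt : 1 / (α + 1) < x) :
    x + y = 1 := by
  have hg := g_pos
  have hα : 1 ≤ α ^ 2 + α := by nlinarith [g_sq]
  rw [div_lt_iff₀ (by linarith)] at hlt
  rcases h with h | h | h
  · exfalso
    have : (x + 1) * α ≤ 1 := by nlinarith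
    nlinarith
  · exfalso
    nlinarith
  · exact h

theorem stmt2 (α : ℝ) (hα : α ∈ Set.Icc g 1) (m : ℕ)
    (h : ∀ n < m, (T α)^[n] (α - 1) ≤ 1 / (α + 1) ∧ (T α)^[n] (1 / α - 1) ≤ 1 / (α + 1)) :
    (∀ n ≤ m,
      ((T α)^[n] (α - 1) + 1) * ((T α)^[n] (1 / α - 1) + 1) = 1 ∨
      (T α)^[n] (α - 1) + (T α)^[n] (1 / α - 1) = 0 ∨
      (T α)^[n] (α - 1) + (T α)^[n] (1 / α - 1) = 1) ∧
    ((1 / (α + 1) < (T α)^[m] (α - 1) ∨ 1 / (α + 1) < (T α)^[m] (1 / α - 1)) →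
      (T α)^[m] (α - 1) + (T α)^[m] (1 / α - 1) = 1) := by
  obtain ⟨hg, h₁⟩ := hα
  have hp : 1 / 2 < α := by linarith [g_pos]
  have h₀ : 0 < α := by linarith
  have main : ∀ n ≤ m,
      ((T α)^[n] (α - 1) + 1) * ((T α)^[n] (1 / α - 1) + 1) = 1 ∨
      (T α)^[n] (α - 1) + (T α)^[n] (1 / α - 1) = 0 ∨
      (T α)^[n] (α - 1) + (T α)^[n] (1 / α - 1) = 1 := by
    intro n
    induction n with
    | zero =>
      intro _
      left
      simp [h₀.ne']
    | succ n ih =>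
      intro hn
      obtain ⟨hx, hy⟩ := h n hn
      have hne : g = α → (T α)^[n] (α - 1) + (T α)^[n] (1 / α - 1) ≠ 1 := by
        rintro rfl
        exact iterate_T_g_add_ne_one n
      simp only [Function.iterate_succ_apply']
      rcases ih (by omega) with hA | hB | hC
      · exact Or.inr (T_add_T_of_mul_eq_one hp h₁ hA)
      · exact Or.inr (T_add_T_of_add_eq_zero hp h₁ hB)
      · exact Or.inl (T_add_one_mul_T_add_one (hg.lt_of_ne fun e => hne e hC) hC hx hy)
  refine ⟨main, ?_⟩
  have bx := sub_one_le_iterate_T h₀ h₁ le_rfl m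
  have hy₀ : α - 1 ≤ 1 / α - 1 := by linarith [one_le_one_div h₀ h₁]
  have bz := sub_one_le_iterate_T h₀ h₁ hy₀ m
  rintro (hlt | hlt)
  · exact add_eq_one_of_one_div_lt hg bx bz (main m le_rfl) hlt
  · rw [add_comm]
    refine add_eq_one_of_one_div_lt hg bz bx ?_ hlt
    rw [mul_comm, add_comm ((T α)^[m] (1 / α - 1)) ((T α)^[m] (α - 1))]
    exact main m le_rfl
end
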